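/- arXiv:gr-qc/0204003 — 5 statements merged into one kernel-verified Lean document; each statement's English description precedes it below -/
import Mathlib

section
/- Suppose the 4-multilinear map R satisfies the exchange symmetry R(x,v,w,y) = R(y,w,v,x) for all x,v,w,y ∈ V, is antisymmetric in its first two arguments (R(x,v,w,y) = −R(v,x,w,y) for all x,v,w,y), and its Ricci form vanishes identically: Ric(v,w) = 0 for all v,w ∈ V. Then the curvature rotation acceleration tensor N vanishes identically and the curvature expansion acceleration I equals 0. -/
/-- If `R` has the exchange symmetry, is antisymmetric in its first two
arguments, and its Ricci form vanishes identically, then the curvature rotation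
acceleration tensor `N` vanishes identically and the curvature expansion
acceleration `I` equals `0`. -/
theorem ricci_flat_implies_N_zero_I_zero
    {V : Type*} [AddCommGroup V] [Module ℝ V] [FiniteDimensional ℝ V]
    (n : ℕ) (hn : Module.finrank ℝ V = n)
    (g : V →ₗ[ℝ] V →ₗ[ℝ] ℝ)
    (hg_symm : ∀ x y : V, g x y = g y x)
    (hg_nd : ∀ x : V, (∀ y : V, g x y = 0) → x = 0)
    (u : V) (he : g u u ≠ 0)
    (P : V → V) (hP : ∀ x : V, P x = x - (g u x / g u u) • u)
    (R : V →ₗ[ℝ] V →ₗ[ℝ] V →ₗ[ℝ] V →ₗ[ℝ] ℝ)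
    (hR_exch : ∀ x v w y : V, R x v w y = R y w v x)
    (hR_anti : ∀ x v w y : V, R x v w y = - R v x w y)
    (hRic : ∀ (v w : V) (T : V →ₗ[ℝ] V),
      (∀ x y : V, g (T x) y = R x v w y) → LinearMap.trace ℝ V T = 0)
    (C : V → V → ℝ) (hC : ∀ x y : V, C x y = R x u u y)
    (M : V → V → ℝ)
    (hM : ∀ x y : V, M x y = (1 / 2) * (C (P x) (P y) + C (P y) (P x)))
    (N : V → V → ℝ)
    (hN : ∀ x y : V, N x y = (1 / 2) * (C (P x) (P y) - C (P y) (P x))) :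
    (∀ x y : V, N x y = 0) ∧
    (∀ LM : V →ₗ[ℝ] V, (∀ x y : V, g (LM x) y = M x y) →
      LinearMap.trace ℝ V LM = 0) := by
  have hu_left (w y : V) : R u u w y = 0 := by linarith [hR_anti u u w y]
  have hu_right (x : V) : R x u u u = 0 := by rw [hR_exch, hu_left]
  have hC_symm (x y : V) : C x y = C y x := by rw [hC, hC, hR_exch]
  have hC_proj_right (x y : V) : C x (P y) = C x y := by
    simp [hC, hP, hu_right]
  have hC_proj (x y : V) : C (P x) (P y) = C x y := by
    rw [hC_proj_right, hC_symm, hC_proj_right, hC_symm]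
  refine ⟨fun x y => ?_, fun LM hLM => hRic u u LM fun x y => ?_⟩
  · rw [hN, hC_symm (P y) (P x), sub_self, mul_zero]
  · rw [hLM, hM, hC_symm (P y) (P x), hC_proj, hC]
    ring
end

section
/- Suppose n ≥ 2 and there is a constant c ∈ ℝ such that R(x,v,w,y) = c·(g(x,y)·g(v,w) − g(x,w)·g(v,y)) for all x,v,w,y ∈ V (the pointwise constant-curvature condition, with c = R₀/(n(n−1)) in the paper's normalization). Then the curvature shear acceleration tensor satisfies M = c·e·h, the curvature rotation acceleration tensor N vanishes identically, the curvature expansion acceleration equals I = c·e·(n−1), and the trace-free curvature shear acceleration tensor vanishes: sM = 0. -/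
/-- In the constant-curvature case
`R(x,v,w,y) = c·(g(x,y)·g(v,w) − g(x,w)·g(v,y))` (with `n ≥ 2`), one has
`M = c·e·h`, `N = 0`, `I = c·e·(n−1)`, and the trace-free curvature shear
acceleration tensor `sM` vanishes. -/
theorem constant_curvature_implies_sM_zero_N_zero
    {V : Type*} [AddCommGroup V] [Module ℝ V] [FiniteDimensional ℝ V]
    (n : ℕ) (hn : Module.finrank ℝ V = n) (hn2 : 2 ≤ n)
    (g : V →ₗ[ℝ] V →ₗ[ℝ] ℝ)
    (hg_symm : ∀ x y : V, g x y = g y x)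
    (hg_nd : ∀ x : V, (∀ y : V, g x y = 0) → x = 0)
    (u : V) (he : g u u ≠ 0)
    (h : V → V → ℝ)
    (hh : ∀ x y : V, h x y = g x y - (1 / g u u) * (g u x * g u y))
    (P : V → V) (hP : ∀ x : V, P x = x - (g u x / g u u) • u)
    (c : ℝ)
    (R : V →ₗ[ℝ] V →ₗ[ℝ] V →ₗ[ℝ] V →ₗ[ℝ] ℝ)
    (hR : ∀ x v w y : V, R x v w y = c * (g x y * g v w - g x w * g v y))
    (C : V → V → ℝ) (hC : ∀ x y : V, C x y = R x u u y)
    (M : V → V → ℝ)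
    (hM : ∀ x y : V, M x y = (1 / 2) * (C (P x) (P y) + C (P y) (P x)))
    (N : V → V → ℝ)
    (hN : ∀ x y : V, N x y = (1 / 2) * (C (P x) (P y) - C (P y) (P x)))
    (LM : V →ₗ[ℝ] V) (hLM : ∀ x y : V, g (LM x) y = M x y) :
    (∀ x y : V, M x y = c * g u u * h x y) ∧
    (∀ x y : V, N x y = 0) ∧
    LinearMap.trace ℝ V LM = c * g u u * ((n : ℝ) - 1) ∧
    (∀ x y : V, M x y - (LinearMap.trace ℝ V LM / ((n : ℝ) - 1)) * h x y = 0) := by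
  have hC' : ∀ x y : V, C (P x) (P y) = c * g u u * h x y := by
    intro x y
    rw [hC, hR, hP, hP, hh]
    simp only [map_sub, map_smul, LinearMap.sub_apply, LinearMap.smul_apply, smul_eq_mul,
      hg_symm x u]
    field_simp
    ring
  have hh_symm : ∀ x y : V, h y x = h x y := by
    intro x y
    rw [hh, hh, hg_symm y x, mul_comm (g u y)]
  have hM' : ∀ x y : V, M x y = c * g u u * h x y := by
    intro x y
    rw [hM, hC', hC', hh_symm x y]
    ring
  have hLM' : LM = (c * g u u) • LinearMap.id - c • (g u).smulRight u := by
    ext x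
    refine sub_eq_zero.mp (hg_nd _ fun y => ?_)
    simp only [LinearMap.sub_apply, LinearMap.smul_apply, LinearMap.id_apply,
      LinearMap.smulRight_apply, map_sub, map_smul, smul_eq_mul, hLM, hM', hh]
    field_simp
    ring
  have htr : LinearMap.trace ℝ V LM = c * g u u * ((n : ℝ) - 1) := by
    rw [hLM', map_sub, map_smul, map_smul, LinearMap.trace_id, LinearMap.trace_smulRight, hn,
      smul_eq_mul, smul_eq_mul]
    ring
  refine ⟨hM', fun x y => ?_, htr, fun x y => ?_⟩
  · rw [hN, hC', hC', hh_symm x y]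
    ring
  · have hn1 : (n : ℝ) - 1 ≠ 0 := by
      have : (2 : ℝ) ≤ n := by exact_mod_cast hn2
      linarith
    rw [htr, hM', mul_div_cancel_right₀ _ hn1, sub_self]
end

section
/- Let C be a bilinear form on V satisfying C(x,u) = 0 for all x ∈ V (the condition K[g(u)] = 0, valid for curvature-induced tensors). Then the curvature rotation acceleration tensor N vanishes identically if and only if C(x,y) − C(y,x) = (1/e)·(g(u,x)·C(u,y) − g(u,y)·C(u,x)) for all x,y ∈ V (the lowered form of the condition K_a = (1/2e)·{u⊗[g(u)](K) − [g(u)](K)⊗u}). -/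
/-- For a bilinear form `C` with `C(x,u) = 0` for all `x`, the
curvature rotation acceleration tensor `N` vanishes identically iff
`C(x,y) − C(y,x) = (1/e)·(g(u,x)·C(u,y) − g(u,y)·C(u,x))` for all `x,y`. -/
theorem N_zero_iff_Ka_condition
    {V : Type*} [AddCommGroup V] [Module ℝ V] [FiniteDimensional ℝ V]
    (n : ℕ) (hn : Module.finrank ℝ V = n)
    (g : V →ₗ[ℝ] V →ₗ[ℝ] ℝ)
    (hg_symm : ∀ x y : V, g x y = g y x)
    (hg_nd : ∀ x : V, (∀ y : V, g x y = 0) → x = 0)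
    (u : V) (he : g u u ≠ 0)
    (P : V → V) (hP : ∀ x : V, P x = x - (g u x / g u u) • u)
    (C : V →ₗ[ℝ] V →ₗ[ℝ] ℝ)
    (hCu : ∀ x : V, C x u = 0)
    (N : V → V → ℝ)
    (hN : ∀ x y : V, N x y = (1 / 2) * (C (P x) (P y) - C (P y) (P x))) :
    (∀ x y : V, N x y = 0) ↔
      (∀ x y : V, C x y - C y x =
        (1 / g u u) * (g u x * C u y - g u y * C u x)) := by
  have key (x y : V) : N x y = (1 / 2) * (C x y - C y x -
      (1 / g u u) * (g u x * C u y - g u y * C u x)) := by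
    simp only [hN, hP, map_sub, map_smul, LinearMap.sub_apply, LinearMap.smul_apply, hCu,
      smul_eq_mul]
    ring
  refine forall₂_congr fun x y => ?_
  rw [key, mul_eq_zero_iff_left (by norm_num), sub_eq_zero]
end

section
/- Suppose the 4-multilinear map R satisfies R(u,u,u,u) = 0 (as holds whenever R is antisymmetric in any pair of its arguments). Then the curvature expansion acceleration of C(x,y) := R(x,u,u,y) equals the Ricci form evaluated on (u,u): I = Ric(u,u). In particular, I = 0 if and only if Ric(u,u) = 0. -/
/-- Endomorphisms that are adjoint with respect to a left-nondegenerate bilinear form have the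
same trace. -/
theorem trace_eq_of_adjoint {K V : Type*} [Field K] [AddCommGroup V] [Module K V]
    [FiniteDimensional K V] (g : V →ₗ[K] V →ₗ[K] K)
    (hg : ∀ x : V, (∀ y : V, g x y = 0) → x = 0)
    (A B : V →ₗ[K] V) (h : ∀ x y : V, g (A x) y = g x (B y)) :
    LinearMap.trace K V A = LinearMap.trace K V B := by
  have hinj : Function.Injective (g : V →ₗ[K] Module.Dual K V) := by
    rw [injective_iff_map_eq_zero]
    exact fun x hx => hg x fun y => LinearMap.congr_fun hx y
  let φ : V ≃ₗ[K] Module.Dual K V :=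
    LinearMap.linearEquivOfInjective g hinj Subspace.dual_finrank_eq.symm
  have hconj : φ.conj A = Module.Dual.transpose B := by
    ext f y
    obtain ⟨x, rfl⟩ := φ.surjective f
    rw [LinearEquiv.conj_apply_apply, LinearEquiv.symm_apply_apply]
    exact h x y
  rw [← LinearMap.trace_conj' A φ, hconj, LinearMap.trace_transpose']

/-- The `g`-orthogonal projection along `u`. -/
noncomputable def projAlong {V : Type*} [AddCommGroup V] [Module ℝ V]
    (g : V →ₗ[ℝ] V →ₗ[ℝ] ℝ) (u : V) : V →ₗ[ℝ] V :=
  LinearMap.id - (g u).smulRight ((g u u)⁻¹ • u)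

theorem projAlong_apply {V : Type*} [AddCommGroup V] [Module ℝ V]
    (g : V →ₗ[ℝ] V →ₗ[ℝ] ℝ) (u x : V) :
    projAlong g u x = x - (g u x / g u u) • u := by
  simp [projAlong, smul_smul, div_eq_mul_inv]

theorem projAlong_comp_self {V : Type*} [AddCommGroup V] [Module ℝ V]
    (g : V →ₗ[ℝ] V →ₗ[ℝ] ℝ) (u : V) (he : g u u ≠ 0) :
    projAlong g u ∘ₗ projAlong g u = projAlong g u := by
  ext x
  simp [projAlong_apply, he]

theorem projAlong_selfAdjoint {V : Type*} [AddCommGroup V] [Module ℝ V]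
    (g : V →ₗ[ℝ] V →ₗ[ℝ] ℝ) (hg_symm : ∀ x y : V, g x y = g y x) (u x y : V) :
    g (projAlong g u x) y = g x (projAlong g u y) := by
  simp only [projAlong_apply, map_sub, map_smul, LinearMap.sub_apply, LinearMap.smul_apply,
    smul_eq_mul, hg_symm x u]
  ring

/-- Compressing `T` to the complement of `u` keeps its trace when `T u` is orthogonal to `u`. -/
theorem trace_projAlong_comp {V : Type*} [AddCommGroup V] [Module ℝ V] [FiniteDimensional ℝ V]
    (g : V →ₗ[ℝ] V →ₗ[ℝ] ℝ) (u : V) (he : g u u ≠ 0)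
    (T : V →ₗ[ℝ] V) (hT : g u (T u) = 0) :
    LinearMap.trace ℝ V (projAlong g u ∘ₗ T ∘ₗ projAlong g u) = LinearMap.trace ℝ V T := by
  have hcomp : T ∘ₗ projAlong g u = T - (g u).smulRight ((g u u)⁻¹ • T u) := by
    ext x
    simp [projAlong]
  rw [LinearMap.trace_comp_comm', LinearMap.comp_assoc, projAlong_comp_self g u he, hcomp, map_sub,
    LinearMap.trace_smulRight, map_smul, hT, smul_zero, sub_zero]


/-- If `R(u,u,u,u) = 0`, then the curvature expansion acceleration
of `C(x,y) := R(x,u,u,y)` equals the Ricci form evaluated on `(u,u)`: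
`I = Ric(u,u)`; in particular `I = 0 ↔ Ric(u,u) = 0`. -/
theorem I_eq_Ricci_uu
    {V : Type*} [AddCommGroup V] [Module ℝ V] [FiniteDimensional ℝ V]
    (n : ℕ) (hn : Module.finrank ℝ V = n)
    (g : V →ₗ[ℝ] V →ₗ[ℝ] ℝ)
    (hg_symm : ∀ x y : V, g x y = g y x)
    (hg_nd : ∀ x : V, (∀ y : V, g x y = 0) → x = 0)
    (u : V) (he : g u u ≠ 0)
    (P : V → V) (hP : ∀ x : V, P x = x - (g u x / g u u) • u)
    (R : V →ₗ[ℝ] V →ₗ[ℝ] V →ₗ[ℝ] V →ₗ[ℝ] ℝ)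
    (hR : R u u u u = 0)
    (C : V → V → ℝ) (hC : ∀ x y : V, C x y = R x u u y)
    (M : V → V → ℝ)
    (hM : ∀ x y : V, M x y = (1 / 2) * (C (P x) (P y) + C (P y) (P x)))
    (LM : V →ₗ[ℝ] V) (hLM : ∀ x y : V, g (LM x) y = M x y)
    (T : V →ₗ[ℝ] V) (hT : ∀ x y : V, g (T x) y = R x u u y) :
    LinearMap.trace ℝ V LM = LinearMap.trace ℝ V T ∧
    (LinearMap.trace ℝ V LM = 0 ↔ LinearMap.trace ℝ V T = 0) := by
  obtain rfl : P = projAlong g u := funext fun x => by rw [hP, projAlong_apply]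
  have hTu : g u (T u) = 0 := by rw [hg_symm, hT, hR]
  set A := projAlong g u ∘ₗ T ∘ₗ projAlong g u with hA
  have hAg (x y : V) : g (A x) y = C (projAlong g u x) (projAlong g u y) := by
    rw [hC, ← hT, ← projAlong_selfAdjoint g hg_symm]
    simp [hA, projAlong_selfAdjoint g hg_symm]
  have hadj : LinearMap.trace ℝ V ((2 : ℝ) • LM - A) = LinearMap.trace ℝ V A := by
    refine trace_eq_of_adjoint g hg_nd _ _ fun x y => ?_
    rw [hg_symm x, hAg, LinearMap.sub_apply, map_sub, LinearMap.sub_apply, hAg,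
      LinearMap.smul_apply, map_smul, LinearMap.smul_apply, hLM, hM, smul_eq_mul]
    ring
  have htr : LinearMap.trace ℝ V LM = LinearMap.trace ℝ V T := by
    rw [map_sub, map_smul, smul_eq_mul, hA, trace_projAlong_comp g u he T hTu] at hadj
    linarith
  exact ⟨htr, by rw [htr]⟩
end

section
/- Let n ≥ 2 and let C be a bilinear form on V with C(x,u) = 0 for all x ∈ V. Then the trace-free curvature shear acceleration tensor sM of C vanishes if and only if (1/2)·(C(x,y) + C(y,x)) = (I/(n−1))·h(x,y) + (1/(2e))·(g(u,x)·C(u,y) + g(u,y)·C(u,x)) for all x,y ∈ V, where I is the curvature expansion acceleration of C (the lowered form of the condition K_s = (1/(n−1))·I·h^u + (1/(2e))·{u⊗[g(u)](K) + [g(u)](K)⊗u}). -/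
/-- For a bilinear form `C` with `C(x,u) = 0` for all `x` and
`n ≥ 2`, the trace-free curvature shear acceleration tensor `sM` of `C`
vanishes iff
`(1/2)·(C(x,y)+C(y,x)) = (I/(n−1))·h(x,y) + (1/(2e))·(g(u,x)·C(u,y)+g(u,y)·C(u,x))`
for all `x,y`, where `I` is the curvature expansion acceleration of `C`. -/
theorem sM_zero_iff_Ks_decomposition
    {V : Type*} [AddCommGroup V] [Module ℝ V] [FiniteDimensional ℝ V]
    (n : ℕ) (hn : Module.finrank ℝ V = n) (hn2 : 2 ≤ n)
    (g : V →ₗ[ℝ] V →ₗ[ℝ] ℝ)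
    (hg_symm : ∀ x y : V, g x y = g y x)
    (hg_nd : ∀ x : V, (∀ y : V, g x y = 0) → x = 0)
    (u : V) (he : g u u ≠ 0)
    (h : V → V → ℝ)
    (hh : ∀ x y : V, h x y = g x y - (1 / g u u) * (g u x * g u y))
    (P : V → V) (hP : ∀ x : V, P x = x - (g u x / g u u) • u)
    (C : V →ₗ[ℝ] V →ₗ[ℝ] ℝ)
    (hCu : ∀ x : V, C x u = 0)
    (M : V → V → ℝ)
    (hM : ∀ x y : V, M x y = (1 / 2) * (C (P x) (P y) + C (P y) (P x)))
    (LM : V →ₗ[ℝ] V) (hLM : ∀ x y : V, g (LM x) y = M x y) :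
    (∀ x y : V,
      M x y - (LinearMap.trace ℝ V LM / ((n : ℝ) - 1)) * h x y = 0) ↔
    (∀ x y : V, (1 / 2) * (C x y + C y x) =
      (LinearMap.trace ℝ V LM / ((n : ℝ) - 1)) * h x y +
      (1 / (2 * g u u)) * (g u x * C u y + g u y * C u x)) := by
  have hMC : ∀ x y : V, M x y = (1 / 2) * (C x y + C y x) -
      (1 / (2 * g u u)) * (g u x * C u y + g u y * C u x) := by
    intro x y
    simp only [hM, hP, map_sub, map_smul, LinearMap.sub_apply, LinearMap.smul_apply, hCu,
      smul_eq_mul]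
    field_simp
    ring
  refine forall₂_congr fun x y => ?_
  rw [hMC]
  constructor <;> intro hxy <;> linarith
end
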